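/- Let $\mathcal{R}$ be an algebraic Kähler curvature tensor on $\mathbb{C}^n$, $n \geq 2$, satisfying NQOBC, and suppose its scalar curvature vanishes: $\sum_{i,j}\mathcal{R}(e_i,\bar e_i,e_j,\bar e_j) = 0$. Then $\mathcal{R}(V,\bar V,W,\bar W) = 0$ for every pair of orthonormal vectors $V, W$, and $\mathcal{R}(V,\bar V,V,\bar V) + \mathcal{R}(W,\bar W,W,\bar W) = 0$ for every orthonormal pair $V, W$. -/

import Mathlib

open Finset

noncomputable section

/-- An algebraic Kähler curvature tensor on `ℂⁿ`: complex linear in the first and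
third (unbarred) slots, conjugate linear in the second and fourth (barred) slots,
with the pair symmetry `R(X,Ȳ,Z,W̄) = R(Z,W̄,X,Ȳ)`, the Kähler symmetry
`R(X,Ȳ,Z,W̄) = R(Z,Ȳ,X,W̄)`, and the reality condition
`conj R(X,Ȳ,Z,W̄) = R(Y,X̄,W,Z̄)`. -/
structure AKCT (n : ℕ) where
  R : (Fin n → ℂ) → (Fin n → ℂ) → (Fin n → ℂ) → (Fin n → ℂ) → ℂ
  smul_fst : ∀ (a : ℂ) (X Y Z W), R (a • X) Y Z W = a * R X Y Z W
  add_fst : ∀ (X X' Y Z W), R (X + X') Y Z W = R X Y Z W + R X' Y Z W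
  smul_snd : ∀ (a : ℂ) (X Y Z W), R X (a • Y) Z W = (starRingEnd ℂ) a * R X Y Z W
  add_snd : ∀ (X Y Y' Z W), R X (Y + Y') Z W = R X Y Z W + R X Y' Z W
  pair_symm : ∀ (X Y Z W), R X Y Z W = R Z W X Y
  kahler_symm : ∀ (X Y Z W), R X Y Z W = R Z Y X W
  conj_symm : ∀ (X Y Z W), (starRingEnd ℂ) (R X Y Z W) = R Y X W Z

/-- The standard Hermitian inner product on `ℂⁿ` (conjugate linear in the first slot). -/
def hermInner {n : ℕ} (v w : Fin n → ℂ) : ℂ := ∑ k, (starRingEnd ℂ) (v k) * w k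

/-- A unitary frame of `ℂⁿ`. -/
def UnitaryFrame {n : ℕ} (e : Fin n → Fin n → ℂ) : Prop :=
  ∀ i j, hermInner (e i) (e j) = if i = j then 1 else 0

/-- An orthonormal (unitary) pair of vectors in `ℂⁿ`. -/
def OrthPair {n : ℕ} (V W : Fin n → ℂ) : Prop :=
  hermInner V V = 1 ∧ hermInner W W = 1 ∧ hermInner V W = 0

/-- Nonnegative quadratic orthogonal bisectional curvature. -/
def NQOBC {n : ℕ} (𝓡 : AKCT n) : Prop :=
  ∀ e : Fin n → Fin n → ℂ, UnitaryFrame e →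
    ∀ ξ : Fin n → ℝ,
      0 ≤ ∑ i, ∑ j, (𝓡.R (e i) (e i) (e j) (e j)).re * (ξ i - ξ j) ^ 2

/-- The `k`-th standard basis vector of `ℂⁿ`. -/
def stdVec {n : ℕ} (k : Fin n) : Fin n → ℂ := fun m => if m = k then 1 else 0

/-- The scalar curvature of an algebraic Kähler curvature tensor
(computed in the standard basis). -/
def scalarCurv {n : ℕ} (𝓡 : AKCT n) : ℝ :=
  ∑ i, ∑ j, (𝓡.R (stdVec i) (stdVec i) (stdVec j) (stdVec j)).re

end

noncomputable section

namespace AKCT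

variable {n : ℕ} (𝓡 : AKCT n)

lemma sum_fst {ι : Type*} (s : Finset ι) (x : ι → ℂ) (e : ι → Fin n → ℂ) (Y Z W : Fin n → ℂ) :
    𝓡.R (∑ i ∈ s, x i • e i) Y Z W = ∑ i ∈ s, x i * 𝓡.R (e i) Y Z W := by
  classical
  induction s using Finset.induction_on with
  | empty => simpa using 𝓡.smul_fst 0 0 Y Z W
  | insert i s hi ih => rw [sum_insert hi, sum_insert hi, 𝓡.add_fst, 𝓡.smul_fst, ih]

lemma sum_snd {ι : Type*} (s : Finset ι) (x : ι → ℂ) (e : ι → Fin n → ℂ) (X Z W : Fin n → ℂ) :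
    𝓡.R X (∑ i ∈ s, x i • e i) Z W =
      ∑ i ∈ s, (starRingEnd ℂ) (x i) * 𝓡.R X (e i) Z W := by
  classical
  induction s using Finset.induction_on with
  | empty => simpa using 𝓡.smul_snd 0 X 0 Z W
  | insert i s hi ih => rw [sum_insert hi, sum_insert hi, 𝓡.add_snd, 𝓡.smul_snd, ih]

lemma smul_thd (a : ℂ) (X Y Z W : Fin n → ℂ) : 𝓡.R X Y (a • Z) W = a * 𝓡.R X Y Z W := by
  rw [𝓡.pair_symm, 𝓡.smul_fst, 𝓡.pair_symm]

lemma add_thd (X Y Z Z' W : Fin n → ℂ) :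
    𝓡.R X Y (Z + Z') W = 𝓡.R X Y Z W + 𝓡.R X Y Z' W := by
  rw [𝓡.pair_symm, 𝓡.add_fst, 𝓡.pair_symm, 𝓡.pair_symm Z']

lemma smul_fth (a : ℂ) (X Y Z W : Fin n → ℂ) :
    𝓡.R X Y Z (a • W) = (starRingEnd ℂ) a * 𝓡.R X Y Z W := by
  rw [𝓡.pair_symm, 𝓡.smul_snd, 𝓡.pair_symm]

lemma add_fth (X Y Z W W' : Fin n → ℂ) :
    𝓡.R X Y Z (W + W') = 𝓡.R X Y Z W + 𝓡.R X Y Z W' := by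
  rw [𝓡.pair_symm, 𝓡.add_snd, 𝓡.pair_symm, 𝓡.pair_symm Z W']

lemma sum_sum {ι : Type*} [Fintype ι] (x : ι → ℂ) (e : ι → Fin n → ℂ) (Z W : Fin n → ℂ) :
    𝓡.R (∑ i, x i • e i) (∑ i, x i • e i) Z W =
      ∑ i, ∑ j, x i * (starRingEnd ℂ) (x j) * 𝓡.R (e i) (e j) Z W := by
  simp only [sum_fst, mul_assoc, ← mul_sum]
  refine sum_congr rfl fun i _ => ?_
  rw [sum_snd]

lemma sum_sum_sum_sum {ι : Type*} [Fintype ι] (x : ι → ℂ) (e : ι → Fin n → ℂ) :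
    𝓡.R (∑ i, x i • e i) (∑ i, x i • e i) (∑ i, x i • e i) (∑ i, x i • e i) =
      ∑ i, ∑ j, ∑ k, ∑ l, x i * (starRingEnd ℂ) (x j) * x k * (starRingEnd ℂ) (x l) *
        𝓡.R (e i) (e j) (e k) (e l) := by
  rw [sum_sum]
  refine sum_congr rfl fun i _ => sum_congr rfl fun j _ => ?_
  rw [𝓡.pair_symm, sum_sum, mul_sum]
  refine sum_congr rfl fun k _ => ?_
  rw [mul_sum]
  refine sum_congr rfl fun l _ => ?_
  rw [𝓡.pair_symm (e k)]
  ring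

lemma im_eq_zero (X Y : Fin n → ℂ) : (𝓡.R X X Y Y).im = 0 :=
  Complex.conj_eq_iff_im.mp (𝓡.conj_symm X X Y Y)

end AKCT

section Frames

variable {n : ℕ}

lemma hermInner_sum {ι κ : Type*} (s : Finset ι) (t : Finset κ) (x : ι → ℂ) (y : κ → ℂ)
    (e : ι → Fin n → ℂ) (f : κ → Fin n → ℂ) :
    hermInner (∑ i ∈ s, x i • e i) (∑ j ∈ t, y j • f j) =
      ∑ i ∈ s, ∑ j ∈ t, (starRingEnd ℂ) (x i) * y j * hermInner (e i) (f j) := by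
  simp only [hermInner, Finset.sum_apply, Pi.smul_apply, smul_eq_mul, map_sum, map_mul,
    sum_mul_sum]
  simp only [mul_sum]
  rw [sum_comm]
  refine sum_congr rfl fun i _ => ?_
  rw [sum_comm]
  refine sum_congr rfl fun j _ => ?_
  refine sum_congr rfl fun k _ => ?_
  ring

lemma hermInner_symm (V W : Fin n → ℂ) : (starRingEnd ℂ) (hermInner V W) = hermInner W V := by
  simp [hermInner, mul_comm]

lemma UnitaryFrame.sum_smul {e : Fin n → Fin n → ℂ} (he : UnitaryFrame e)
    {U : Fin n → Fin n → ℂ} (hU : UnitaryFrame U) :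
    UnitaryFrame fun k => ∑ j, U k j • e j := by
  intro k l
  rw [hermInner_sum, ← hU k l]
  have he' : ∀ i j, hermInner (e i) (e j) = if i = j then 1 else 0 := he
  simp only [he']
  simp [hermInner]

lemma UnitaryFrame.sum_mul_conj {e : Fin n → Fin n → ℂ} (he : UnitaryFrame e) (a b : Fin n) :
    ∑ i, e i a * (starRingEnd ℂ) (e i b) = if a = b then 1 else 0 := by
  have h1 : (Matrix.of e).map (starRingEnd ℂ) * (Matrix.of e).transpose = 1 := by
    ext i j
    simpa [Matrix.mul_apply, Matrix.one_apply, hermInner] using he i j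
  have h2 := congrArg (fun M => M a b) (mul_eq_one_comm.mp h1)
  simpa [Matrix.mul_apply, Matrix.one_apply] using h2

lemma sum_smul_stdVec (v : Fin n → ℂ) : ∑ a, v a • stdVec a = v := by
  ext m
  simp [stdVec, Finset.sum_apply]

lemma UnitaryFrame.trace_eq (𝓡 : AKCT n) {e : Fin n → Fin n → ℂ} (he : UnitaryFrame e)
    (Z W : Fin n → ℂ) :
    ∑ i, 𝓡.R (e i) (e i) Z W = ∑ a, 𝓡.R (stdVec a) (stdVec a) Z W := by
  have h : ∀ i, 𝓡.R (e i) (e i) Z W =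
      ∑ a, ∑ b, e i a * (starRingEnd ℂ) (e i b) * 𝓡.R (stdVec a) (stdVec b) Z W := by
    intro i
    rw [← 𝓡.sum_sum, sum_smul_stdVec]
  simp only [h]
  rw [sum_comm]
  refine sum_congr rfl fun a _ => ?_
  rw [sum_comm]
  simp [← sum_mul, he.sum_mul_conj]

/-- The scalar curvature may be computed in any unitary frame. -/
lemma UnitaryFrame.scalarCurv_eq (𝓡 : AKCT n) {e : Fin n → Fin n → ℂ} (he : UnitaryFrame e) :
    ∑ i, ∑ j, (𝓡.R (e i) (e i) (e j) (e j)).re = scalarCurv 𝓡 := by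
  have h : ∑ i, ∑ j, 𝓡.R (e i) (e i) (e j) (e j) =
      ∑ i, ∑ j, 𝓡.R (stdVec i) (stdVec i) (stdVec j) (stdVec j) := by
    rw [sum_comm]
    simp only [he.trace_eq 𝓡]
    rw [sum_comm]
    refine sum_congr rfl fun a _ => ?_
    simp only [𝓡.pair_symm (stdVec a)]
    exact he.trace_eq 𝓡 _ _
  simpa [scalarCurv] using congrArg Complex.re h

/-- An orthonormal pair extends to a unitary frame. -/
lemma OrthPair.exists_unitaryFrame {V W : Fin n → ℂ} (h : OrthPair V W) {k l : Fin n}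
    (hkl : k ≠ l) : ∃ e, UnitaryFrame e ∧ e k = V ∧ e l = W := by
  have hin : ∀ v w : Fin n → ℂ, inner ℂ (WithLp.toLp 2 v) (WithLp.toLp 2 w) = hermInner v w := by
    intro v w
    simp [hermInner, PiLp.inner_apply, mul_comm]
  let v : Fin n → EuclideanSpace ℂ (Fin n) :=
    fun i => if i = k then WithLp.toLp 2 V else WithLp.toLp 2 W
  have hWV : hermInner W V = 0 := by rw [← hermInner_symm, h.2.2, map_zero]
  have hv : Orthonormal ℂ (({k, l} : Set (Fin n)).domRestrict v) := by
    rw [orthonormal_iff_ite]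
    rintro ⟨i, rfl | rfl⟩ ⟨j, rfl | rfl⟩ <;>
      simp only [Set.domRestrict_apply, v] <;>
      simp [hin, -inner_self_eq_norm_sq_to_K, Subtype.ext_iff, h.1, h.2.1, h.2.2, hWV, hkl,
        hkl.symm]
  obtain ⟨b, hb⟩ := hv.exists_orthonormalBasis_extension_of_card_eq (by simp)
  refine ⟨fun i => WithLp.ofLp (b i), fun i j => ?_, ?_, ?_⟩
  · rw [← hin]
    exact orthonormal_iff_ite.mp b.orthonormal i j
  · simp [hb k (by simp), v]
  · simp [hb l (by simp), v, hkl.symm]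

end Frames

section Phases

variable {n : ℕ}

/-- The fourth root of unity `I ^ x`. -/
def phase (x : ZMod 4) : ℂ := Complex.I ^ x.val

lemma phase_add_one (x : ZMod 4) : phase (x + 1) = Complex.I * phase x := by
  have h : ∀ x : ZMod 4, (x + 1).val = x.val + 1 ∨ (x.val = 3 ∧ (x + 1).val = 0) := by decide
  rcases h x with h | ⟨h, h'⟩
  · rw [phase, phase, h, pow_succ']
  · rw [phase, phase, h, h', ← pow_succ', Complex.I_pow_four, pow_zero]

lemma conj_phase_mul (x : ZMod 4) : (starRingEnd ℂ) (phase x) * phase x = 1 := by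
  rw [← Complex.normSq_eq_conj_mul_self]
  simp [phase]

lemma phase_add_single (a : Fin n → ZMod 4) (m i : Fin n) :
    phase ((a + Pi.single m 1 : Fin n → ZMod 4) i) = (if i = m then Complex.I else 1) * phase (a i) := by
  by_cases h : i = m
  · subst h
    simp [phase_add_one]
  · simp [h]

/-- Fourth moments of independent uniformly distributed phases. -/
lemma sum_phase (i j k l : Fin n) :
    ∑ a : Fin n → ZMod 4, phase (a i) * (starRingEnd ℂ) (phase (a j)) * phase (a k) *
        (starRingEnd ℂ) (phase (a l)) =
      4 ^ n * ((if i = j ∧ k = l then 1 else 0) + (if i = l ∧ k = j then 1 else 0) -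
        (if i = j ∧ k = l ∧ i = k then 1 else 0)) := by
  set F : (Fin n → ZMod 4) → ℂ := fun a => phase (a i) * (starRingEnd ℂ) (phase (a j)) *
    phase (a k) * (starRingEnd ℂ) (phase (a l)) with hF
  have shift : ∀ m, ∑ a, F a = (if i = m then Complex.I else 1) *
      (starRingEnd ℂ) (if j = m then Complex.I else 1) * (if k = m then Complex.I else 1) *
      (starRingEnd ℂ) (if l = m then Complex.I else 1) * ∑ a, F a := by
    intro m
    rw [mul_sum, ← Equiv.sum_comp (Equiv.addRight (Pi.single m (1 : ZMod 4)))]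
    refine sum_congr rfl fun a _ => ?_
    simp only [hF, Equiv.coe_addRight, phase_add_single, map_mul]
    ring
  have kill : ∀ c : ℂ, c ≠ 1 → ∑ a, F a = c * ∑ a, F a → ∑ a, F a = 0 := by
    intro c hc h
    have : (c - 1) * ∑ a, F a = 0 := by linear_combination -h
    exact (mul_eq_zero.mp this).resolve_left (sub_ne_zero.mpr hc)
  have hI : Complex.I ≠ 1 := by simp [Complex.ext_iff]
  have hI2 : (-1 : ℂ) ≠ 1 := by norm_num
  have one : (∀ a, F a = 1) → ∑ a, F a = 4 ^ n := by
    intro h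
    simp [h, ZMod.card]
  by_cases h1 : i = j
  · subst h1
    by_cases h2 : k = l
    · subst h2
      have hF1 : ∀ a, F a = 1 := fun a => by
        linear_combination (phase (a k) * (starRingEnd ℂ) (phase (a k))) *
          conj_phase_mul (a i) + conj_phase_mul (a k)
      rw [one hF1]
      by_cases h3 : i = k
      · simp [h3]
      · simp [h3, Ne.symm h3]
    · have h4 : ¬(i = l ∧ k = i) := by rintro ⟨rfl, rfl⟩; exact h2 rfl
      rw [if_neg fun h => h2 h.2, if_neg h4, if_neg fun h => h2 h.2.1]
      have h5 := shift k
      rw [if_neg (Ne.symm h2)] at h5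
      simp only [add_zero, sub_zero, mul_zero]
      refine kill Complex.I hI (h5.trans ?_)
      by_cases h3 : i = k <;> simp [h3]
  · by_cases h2 : i = l
    · subst h2
      by_cases h3 : k = j
      · subst h3
        have hF1 : ∀ a, F a = 1 := fun a => by
          linear_combination (phase (a k) * (starRingEnd ℂ) (phase (a k))) *
            conj_phase_mul (a i) + conj_phase_mul (a k)
        rw [one hF1]
        simp [h1]
      · rw [if_neg fun h => h1 h.1, if_neg fun h => h3 h.2, if_neg fun h => h1 h.1]
        have h5 := shift k
        rw [if_neg (Ne.symm h3)] at h5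
        simp only [add_zero, sub_zero, mul_zero]
        refine kill Complex.I hI (h5.trans ?_)
        by_cases h4 : i = k <;> simp [h4]
    · rw [if_neg fun h => h1 h.1, if_neg fun h => h2 h.1, if_neg fun h => h1 h.1]
      have h5 := shift i
      rw [if_neg (Ne.symm h1), if_neg (Ne.symm h2)] at h5
      simp only [add_zero, sub_zero, mul_zero]
      by_cases h4 : k = i
      · exact kill (-1) hI2 (h5.trans (by simp [h4]))
      · exact kill Complex.I hI (h5.trans (by simp [h4]))

end Phases

section Fourier

variable {n : ℕ}

/-- The discrete Fourier frame of `ℂⁿ`, with the `j`-th coordinate rotated by `phase (a j)`. -/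
def fourierFrame (n : ℕ) (a : Fin n → ZMod 4) (k j : Fin n) : ℂ :=
  (Real.sqrt n : ℂ)⁻¹ * phase (a j) * Complex.exp (2 * Real.pi * Complex.I / n) ^ (j.val * k.val)

lemma conj_exp_mul_exp (n : ℕ) :
    (starRingEnd ℂ) (Complex.exp (2 * Real.pi * Complex.I / n)) *
      Complex.exp (2 * Real.pi * Complex.I / n) = 1 := by
  rw [← Complex.exp_conj, ← Complex.exp_add, map_div₀, map_mul, map_mul, Complex.conj_I,
    Complex.conj_ofReal, map_ofNat, map_natCast]
  simp [neg_div]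

lemma sqrt_inv_mul_sqrt_inv (n : ℕ) : (Real.sqrt n : ℂ)⁻¹ * (Real.sqrt n : ℂ)⁻¹ = (n : ℂ)⁻¹ := by
  rw [← mul_inv, ← Complex.ofReal_mul, Real.mul_self_sqrt (Nat.cast_nonneg n),
    Complex.ofReal_natCast]

lemma fourierFrame_unitaryFrame (hn : n ≠ 0) (a : Fin n → ZMod 4) :
    UnitaryFrame (fourierFrame n a) := by
  intro k l
  set ζ := Complex.exp (2 * Real.pi * Complex.I / n) with hζ
  have hprim : IsPrimitiveRoot ζ n := Complex.isPrimitiveRoot_exp n hn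
  have hconj : (starRingEnd ℂ) ζ * ζ = 1 := conj_exp_mul_exp n
  have hn' : (n : ℂ) ≠ 0 := by exact_mod_cast hn
  have hterm : ∀ j : Fin n, (starRingEnd ℂ) (fourierFrame n a k j) * fourierFrame n a l j =
      (n : ℂ)⁻¹ * ((starRingEnd ℂ) ζ ^ k.val * ζ ^ l.val) ^ j.val := by
    intro j
    simp only [fourierFrame, ← hζ, map_mul, map_pow, map_inv₀, Complex.conj_ofReal]
    rw [mul_pow, ← pow_mul, ← pow_mul, mul_comm k.val, mul_comm l.val, ← sqrt_inv_mul_sqrt_inv]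
    linear_combination ((Real.sqrt n : ℂ)⁻¹ * (Real.sqrt n : ℂ)⁻¹ *
      (starRingEnd ℂ) ζ ^ (j.val * k.val) * ζ ^ (j.val * l.val)) * conj_phase_mul (a j)
  rw [hermInner, sum_congr rfl fun j _ => hterm j, ← mul_sum,
    Fin.sum_univ_eq_sum_range fun j => ((starRingEnd ℂ) ζ ^ k.val * ζ ^ l.val) ^ j]
  by_cases hkl : k = l
  · subst hkl
    simp [← mul_pow, hconj, hn']
  · rw [if_neg hkl]
    have hne : (starRingEnd ℂ) ζ ^ k.val * ζ ^ l.val ≠ 1 := by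
      intro h
      apply hkl
      apply Fin.ext
      apply hprim.pow_inj k.isLt l.isLt
      have : ((starRingEnd ℂ) ζ * ζ) ^ k.val = 1 := by rw [hconj, one_pow]
      rw [mul_pow] at this
      linear_combination ζ ^ l.val * this - ζ ^ k.val * h
    have hpow : ((starRingEnd ℂ) ζ ^ k.val * ζ ^ l.val) ^ n = 1 := by
      rw [mul_pow, ← pow_mul, ← pow_mul, mul_comm k.val, mul_comm l.val, pow_mul, pow_mul,
        ← map_pow, hprim.pow_eq_one]
      simp
    rw [geom_sum_eq hne, hpow]
    simp

lemma sum_fourierFrame (n : ℕ) (m i j k l : Fin n) :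
    ∑ a, fourierFrame n a m i * (starRingEnd ℂ) (fourierFrame n a m j) * fourierFrame n a m k *
        (starRingEnd ℂ) (fourierFrame n a m l) =
      (n : ℂ)⁻¹ ^ 2 * 4 ^ n * ((if i = j ∧ k = l then 1 else 0) +
        (if i = l ∧ k = j then 1 else 0) - (if i = j ∧ k = l ∧ i = k then 1 else 0)) := by
  set ζ := Complex.exp (2 * Real.pi * Complex.I / n) with hζ
  have hconj : ∀ p : ℕ, (starRingEnd ℂ) ζ ^ p * ζ ^ p = 1 := fun p => by
    rw [← mul_pow, conj_exp_mul_exp n, one_pow]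
  set z : Fin n → ℂ := fun i => ζ ^ (i.val * m.val) with hz
  have hzz : ∀ i, z i * (starRingEnd ℂ) (z i) = 1 := fun i => by
    rw [hz, mul_comm, map_pow]; exact hconj _
  have hterm : ∀ a, fourierFrame n a m i * (starRingEnd ℂ) (fourierFrame n a m j) *
      fourierFrame n a m k * (starRingEnd ℂ) (fourierFrame n a m l) =
      (n : ℂ)⁻¹ ^ 2 * (z i * (starRingEnd ℂ) (z j) * z k * (starRingEnd ℂ) (z l)) *
        (phase (a i) * (starRingEnd ℂ) (phase (a j)) * phase (a k) *
        (starRingEnd ℂ) (phase (a l))) := by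
    intro a
    rw [← sqrt_inv_mul_sqrt_inv]
    simp only [fourierFrame, ← hζ, map_mul, map_inv₀, Complex.conj_ofReal, hz]
    ring
  rw [sum_congr rfl fun a _ => hterm a, ← mul_sum, sum_phase]
  have hc : ∀ i k, z i * (starRingEnd ℂ) (z i) * z k * (starRingEnd ℂ) (z k) = 1 := fun i k => by
    linear_combination (z k * (starRingEnd ℂ) (z k)) * hzz i + hzz k
  by_cases h1 : i = j ∧ k = l
  · obtain ⟨rfl, rfl⟩ := h1
    rw [hc]
    ring
  · by_cases h2 : i = l ∧ k = j
    · obtain ⟨rfl, rfl⟩ := h2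
      rw [show z i * (starRingEnd ℂ) (z k) * z k * (starRingEnd ℂ) (z i) = 1 by
        linear_combination hc i k]
      ring
    · have h3 : ¬(i = j ∧ k = l ∧ i = k) := fun h => h1 ⟨h.1, h.2.1⟩
      simp [h1, h2, h3]

/-- The sum of `H` over the rotated Fourier frames built on `e`. -/
lemma sum_holomorphic_fourierFrame (hn : n ≠ 0) (𝓡 : AKCT n) (e : Fin n → Fin n → ℂ) :
    ∑ a, ∑ m, 𝓡.R (∑ j, fourierFrame n a m j • e j) (∑ j, fourierFrame n a m j • e j)
        (∑ j, fourierFrame n a m j • e j) (∑ j, fourierFrame n a m j • e j) =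
      (n : ℂ)⁻¹ * 4 ^ n * (2 * ∑ i, ∑ j, 𝓡.R (e i) (e i) (e j) (e j) -
        ∑ i, 𝓡.R (e i) (e i) (e i) (e i)) := by
  have key : ∀ m, ∑ a, 𝓡.R (∑ j, fourierFrame n a m j • e j) (∑ j, fourierFrame n a m j • e j)
        (∑ j, fourierFrame n a m j • e j) (∑ j, fourierFrame n a m j • e j) =
      (n : ℂ)⁻¹ ^ 2 * 4 ^ n * (2 * ∑ i, ∑ j, 𝓡.R (e i) (e i) (e j) (e j) -
        ∑ i, 𝓡.R (e i) (e i) (e i) (e i)) := by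
    intro m
    have hsum : ∑ a, 𝓡.R (∑ j, fourierFrame n a m j • e j) (∑ j, fourierFrame n a m j • e j)
        (∑ j, fourierFrame n a m j • e j) (∑ j, fourierFrame n a m j • e j) =
        ∑ i, ∑ j, ∑ k, ∑ l, (∑ a, fourierFrame n a m i * (starRingEnd ℂ) (fourierFrame n a m j) *
          fourierFrame n a m k * (starRingEnd ℂ) (fourierFrame n a m l)) *
          𝓡.R (e i) (e j) (e k) (e l) := by
      simp only [𝓡.sum_sum_sum_sum]
      rw [sum_comm]; refine sum_congr rfl fun i _ => ?_
      rw [sum_comm]; refine sum_congr rfl fun j _ => ?_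
      rw [sum_comm]; refine sum_congr rfl fun k _ => ?_
      rw [sum_comm]; refine sum_congr rfl fun l _ => ?_
      rw [sum_mul]
    rw [hsum]
    simp only [sum_fourierFrame, mul_assoc ((n : ℂ)⁻¹ ^ 2 * 4 ^ n), ← mul_sum]
    congr 1
    simp only [add_mul, sub_mul, sum_add_distrib, sum_sub_distrib, ite_and, ite_mul, one_mul,
      zero_mul, sum_ite_eq, sum_ite_eq', mem_univ, if_true, sum_ite_irrel, sum_const_zero]
    have hk : ∀ i k, 𝓡.R (e i) (e k) (e k) (e i) = 𝓡.R (e i) (e i) (e k) (e k) := fun i k => by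
      rw [𝓡.kahler_symm, 𝓡.pair_symm]
    simp only [hk]
    ring
  rw [sum_comm, sum_congr rfl fun m _ => key m]
  have hn' : (n : ℂ) ≠ 0 := by exact_mod_cast hn
  simp only [sum_const, card_univ, Fintype.card_fin, nsmul_eq_mul]
  field_simp

end Fourier

section Vanishing

variable {n : ℕ}

lemma sum_mul_sq_indicator (r : Fin n → Fin n → ℝ) (hr : ∀ i j, r i j = r j i) (k : Fin n) :
    ∑ i, ∑ j, r i j * ((if i = k then 1 else 0) - (if j = k then 1 else 0)) ^ 2 =
      2 * (∑ j, r k j - r k k) := by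
  have h : ∀ i j, r i j * ((if i = k then (1 : ℝ) else 0) - (if j = k then 1 else 0)) ^ 2 =
      (if i = k then r i j else 0) + (if j = k then r i j else 0) -
        2 * (if i = k then (if j = k then r i j else 0) else 0) := by
    intro i j
    split_ifs <;> ring
  simp only [h, sum_add_distrib, sum_sub_distrib, ← mul_sum, sum_ite_eq', mem_univ, if_true,
    sum_ite_irrel, sum_const_zero, hr _ k]
  ring

lemma sum_mul_sq_indicator_pair (r : Fin n → Fin n → ℝ) (hr : ∀ i j, r i j = r j i)
    {k l : Fin n} (hkl : k ≠ l) :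
    ∑ i, ∑ j, r i j * (((if i = k then 1 else 0) + (if i = l then 1 else 0)) -
        ((if j = k then 1 else 0) + (if j = l then 1 else 0))) ^ 2 =
      2 * (∑ j, r k j - r k k) + 2 * (∑ j, r l j - r l l) - 4 * r k l := by
  rw [← sum_mul_sq_indicator r hr k, ← sum_mul_sq_indicator r hr l]
  have h : ∀ i j, r i j * (((if i = k then (1 : ℝ) else 0) + (if i = l then 1 else 0)) -
        ((if j = k then 1 else 0) + (if j = l then 1 else 0))) ^ 2 =
      r i j * ((if i = k then 1 else 0) - (if j = k then 1 else 0)) ^ 2 +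
      r i j * ((if i = l then 1 else 0) - (if j = l then 1 else 0)) ^ 2 -
      2 * ((if i = k then (if j = l then r i j else 0) else 0) +
        (if i = l then (if j = k then r i j else 0) else 0)) := by
    intro i j
    split_ifs <;> first | (subst_vars; exact absurd rfl hkl) | ring
  simp only [h, sum_add_distrib, sum_sub_distrib, ← mul_sum, sum_ite_eq', mem_univ, if_true,
    sum_ite_irrel, sum_const_zero, hr l k]
  ring

variable {𝓡 : AKCT n}

lemma NQOBC.row_nonneg (h : NQOBC 𝓡) {e : Fin n → Fin n → ℂ} (he : UnitaryFrame e) (k : Fin n) :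
    0 ≤ ∑ j, (𝓡.R (e k) (e k) (e j) (e j)).re - (𝓡.R (e k) (e k) (e k) (e k)).re := by
  have h1 := h e he fun i => if i = k then 1 else 0
  rw [sum_mul_sq_indicator (fun i j => (𝓡.R (e i) (e i) (e j) (e j)).re)
    fun i j => by rw [𝓡.pair_symm]] at h1
  linarith

lemma NQOBC.sum_holomorphic_nonpos (h : NQOBC 𝓡) (hS : scalarCurv 𝓡 = 0)
    {e : Fin n → Fin n → ℂ} (he : UnitaryFrame e) :
    ∑ i, (𝓡.R (e i) (e i) (e i) (e i)).re ≤ 0 := by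
  have h1 := sum_nonneg fun k (_ : k ∈ univ) => h.row_nonneg he k
  rw [sum_sub_distrib, he.scalarCurv_eq, hS] at h1
  linarith

lemma NQOBC.sum_holomorphic_eq_zero (h : NQOBC 𝓡) (hS : scalarCurv 𝓡 = 0) (hn : n ≠ 0)
    {e : Fin n → Fin n → ℂ} (he : UnitaryFrame e) :
    ∑ i, (𝓡.R (e i) (e i) (e i) (e i)).re = 0 := by
  refine le_antisymm (h.sum_holomorphic_nonpos hS he) ?_
  have h1 := congrArg Complex.re (sum_holomorphic_fourierFrame hn 𝓡 e)
  have h2 : (n : ℂ)⁻¹ * 4 ^ n = (((n : ℝ)⁻¹ * 4 ^ n : ℝ) : ℂ) := by push_cast; rfl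
  rw [h2, Complex.re_ofReal_mul, Complex.sub_re, ← Complex.ofReal_ofNat, Complex.re_ofReal_mul]
    at h1
  simp only [Complex.re_sum] at h1
  rw [he.scalarCurv_eq, hS] at h1
  have h3 := sum_nonpos fun a (_ : a ∈ univ) =>
    h.sum_holomorphic_nonpos hS (he.sum_smul (fourierFrame_unitaryFrame hn a))
  rw [h1] at h3
  have h4 : 0 < (n : ℝ)⁻¹ * 4 ^ n := by
    have : 0 < (n : ℝ) := by exact_mod_cast Nat.pos_of_ne_zero hn
    positivity
  have := nonpos_of_mul_nonpos_right h3 h4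
  linarith

lemma NQOBC.re_eq_zero_of_frame (h : NQOBC 𝓡) (hS : scalarCurv 𝓡 = 0)
    {e : Fin n → Fin n → ℂ} (he : UnitaryFrame e) {k l : Fin n} (hkl : k ≠ l) :
    (𝓡.R (e k) (e k) (e l) (e l)).re = 0 := by
  have hn : n ≠ 0 := by
    rintro rfl
    exact k.elim0
  have hrow : ∀ k, ∑ j, (𝓡.R (e k) (e k) (e j) (e j)).re =
      (𝓡.R (e k) (e k) (e k) (e k)).re := by
    have hsum : ∑ k, (∑ j, (𝓡.R (e k) (e k) (e j) (e j)).re -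
        (𝓡.R (e k) (e k) (e k) (e k)).re) = 0 := by
      rw [sum_sub_distrib, he.scalarCurv_eq, hS, h.sum_holomorphic_eq_zero hS hn he, sub_zero]
    intro k
    have := (sum_eq_zero_iff_of_nonneg fun k _ => h.row_nonneg he k).mp hsum k (mem_univ k)
    linarith
  have hle : ∀ l, k ≠ l → (𝓡.R (e k) (e k) (e l) (e l)).re ≤ 0 := by
    intro l hkl
    have h1 := h e he fun i => (if i = k then 1 else 0) + (if i = l then 1 else 0)
    rw [sum_mul_sq_indicator_pair (fun i j => (𝓡.R (e i) (e i) (e j) (e j)).re)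
      (fun i j => by rw [𝓡.pair_symm]) hkl] at h1
    have := hrow k
    have := hrow l
    linarith
  have h1 := hrow k
  rw [← add_sum_erase _ _ (mem_univ k), add_eq_left] at h1
  exact (sum_eq_zero_iff_of_nonpos fun j hj => hle j (ne_of_mem_erase hj).symm).mp h1 l
    (mem_erase.mpr ⟨hkl.symm, mem_univ l⟩)

lemma OrthPair.rotate {V W : Fin n → ℂ} (h : OrthPair V W) {a c : ℂ}
    (ha : (starRingEnd ℂ) a * a = 1) (hc : (starRingEnd ℂ) c * c = 1 / 2) :
    OrthPair (c • (V + a • W)) (c • (V + (-a) • W)) := by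
  obtain ⟨h1, h2, h3⟩ := h
  have h4 : hermInner W V = 0 := by rw [← hermInner_symm, h3, map_zero]
  have key : ∀ x y : ℂ, hermInner (c • (V + x • W)) (c • (V + y • W)) =
      1 / 2 * (1 + (starRingEnd ℂ) x * y) := by
    intro x y
    have hv : ∀ x : ℂ, c • (V + x • W) = ∑ i : Fin 2, ![c, c * x] i • ![V, W] i := by
      intro x
      simp [Fin.sum_univ_two, smul_smul]
    rw [hv, hv, hermInner_sum]
    simp only [Fin.sum_univ_two, Matrix.cons_val_zero, Matrix.cons_val_one, h1, h2, h3, h4,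
      map_mul, ← hc]
    ring
  refine ⟨?_, ?_, ?_⟩ <;> rw [key] <;> simp [ha] <;> norm_num

/-- Polarization: averaging the orthogonal bisectional curvatures of `V ± W` and `V ± I W`. -/
lemma AKCT.add_bisectional (𝓡 : AKCT n) (V W : Fin n → ℂ) :
    𝓡.R (V + (1 : ℂ) • W) (V + (1 : ℂ) • W) (V + (-1 : ℂ) • W) (V + (-1 : ℂ) • W) +
      𝓡.R (V + Complex.I • W) (V + Complex.I • W) (V + (-Complex.I) • W)
        (V + (-Complex.I) • W) = 2 * (𝓡.R V V V V + 𝓡.R W W W W) := by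
  simp only [𝓡.add_fst, 𝓡.add_snd, 𝓡.add_thd, 𝓡.add_fth, 𝓡.smul_fst, 𝓡.smul_snd, 𝓡.smul_thd,
    𝓡.smul_fth, map_neg, map_one, Complex.conj_I]
  rw [𝓡.pair_symm W V V V, 𝓡.pair_symm V W V V, 𝓡.pair_symm W W W V, 𝓡.pair_symm W W V W,
    𝓡.pair_symm W W V V, 𝓡.kahler_symm V W W V, 𝓡.pair_symm W W V V, 𝓡.kahler_symm W V V W]
  ring_nf
  simp only [Complex.I_sq, Complex.I_pow_four]
  ring

end Vanishing

/-- equality case of Theorem 3.1: NQOBC together with vanishing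
scalar curvature forces all orthogonal bisectional curvatures to vanish and
`H(V) + H(W) = 0` for every orthonormal pair. -/
theorem stmt12 (n : ℕ) (hn : 2 ≤ n) (𝓡 : AKCT n) (h : NQOBC 𝓡)
    (hS : scalarCurv 𝓡 = 0) :
    (∀ V W : Fin n → ℂ, OrthPair V W → 𝓡.R V V W W = 0) ∧
      (∀ V W : Fin n → ℂ, OrthPair V W → 𝓡.R V V V V + 𝓡.R W W W W = 0) := by
  have hB : ∀ V W : Fin n → ℂ, OrthPair V W → 𝓡.R V V W W = 0 := by
    intro V W hVW
    have hkl : (⟨0, by omega⟩ : Fin n) ≠ ⟨1, by omega⟩ := by simp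
    obtain ⟨e, he, rfl, rfl⟩ := hVW.exists_unitaryFrame hkl
    exact Complex.ext (h.re_eq_zero_of_frame hS he hkl) (𝓡.im_eq_zero _ _)
  refine ⟨hB, fun V W hVW => ?_⟩
  obtain ⟨c, hc⟩ : ∃ c : ℂ, (starRingEnd ℂ) c * c = 1 / 2 := by
    refine ⟨(Real.sqrt (1 / 2) : ℝ), ?_⟩
    rw [Complex.conj_ofReal, ← Complex.ofReal_mul, Real.mul_self_sqrt (by norm_num)]
    norm_num
  have hrot : ∀ a : ℂ, (starRingEnd ℂ) a * a = 1 →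
      𝓡.R (V + a • W) (V + a • W) (V + (-a) • W) (V + (-a) • W) = 0 := by
    intro a ha
    have h1 := hB _ _ (hVW.rotate ha hc)
    rw [𝓡.smul_fst, 𝓡.smul_snd, 𝓡.smul_thd, 𝓡.smul_fth] at h1
    linear_combination 4 * h1 - (4 * (starRingEnd ℂ) c * c + 2) *
      𝓡.R (V + a • W) (V + a • W) (V + (-a) • W) (V + (-a) • W) * hc
  have h2 := 𝓡.add_bisectional V W
  rw [hrot 1 (by simp), hrot Complex.I (by simp)] at h2
  linear_combination -h2 / 2

end
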